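/- arXiv:1608.01371 — 3 statements merged into one kernel-verified Lean document; each statement's English description precedes it below -/
import Mathlib

section
/- Let N ≥ 3 and let G be a subgroup of (ℤ/2^Nℤ)ˣ containing the class of −1, acting on M = ℤ/2^Nℤ by multiplication. Then the first group cohomology H¹(G, M) is isomorphic to ℤ/2ℤ; equivalently, the quotient of the group of 1-cocycles f : G → M (functions satisfying f(gh) = f(g) + g·f(h)) by the subgroup of coboundaries (functions of the form g ↦ g·m − m) has exactly two elements. -/
/-- `f : G → ℤ/nℤ` is a 1-cocycle for the subgroup `G ≤ (ℤ/nℤ)ˣ` acting on `M = ℤ/nℤ`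
by multiplication: `f(gh) = f(g) + g·f(h)` for all `g, h ∈ G`. -/
def IsCocycle {n : ℕ} (G : Subgroup (ZMod n)ˣ) (f : G → ZMod n) : Prop :=
  ∀ g h : G, f (g * h) = f g + ((g : (ZMod n)ˣ) : ZMod n) * f h

/-- `f : G → ℤ/nℤ` is a 1-coboundary: there is `m ∈ M` with `f(g) = g·m − m` for all `g ∈ G`. -/
def IsCoboundary {n : ℕ} (G : Subgroup (ZMod n)ˣ) (f : G → ZMod n) : Prop :=
  ∃ m : ZMod n, ∀ g : G, f g = ((g : (ZMod n)ˣ) : ZMod n) * m - m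

namespace ZMod

theorem two_pow_dvd_of_two_pow_mul_eq_zero {N j : ℕ} (hj : j ≤ N) {x : ZMod (2 ^ N)}
    (h : 2 ^ j * x = 0) : 2 ^ (N - j) ∣ x := by
  obtain ⟨n, rfl⟩ := ZMod.natCast_zmod_surjective x
  have h' : ((2 ^ j * n : ℕ) : ZMod (2 ^ N)) = 0 := by exact_mod_cast h
  rw [ZMod.natCast_eq_zero_iff, ← Nat.add_sub_cancel' hj, pow_add] at h'
  obtain ⟨m, hm⟩ := Nat.dvd_of_mul_dvd_mul_left (by positivity) h'
  exact ⟨m, by rw [hm]; simp⟩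

theorem two_pow_self_eq_zero (N : ℕ) : (2 : ZMod (2 ^ N)) ^ N = 0 := by
  exact_mod_cast ZMod.natCast_self (2 ^ N)

theorem two_dvd_or_two_dvd_sub_one {N : ℕ} (x : ZMod (2 ^ N)) : 2 ∣ x ∨ 2 ∣ x - 1 := by
  obtain ⟨n, rfl⟩ := ZMod.natCast_zmod_surjective x
  rcases Nat.even_or_odd' n with ⟨m, rfl | rfl⟩
  · exact Or.inl ⟨m, by push_cast; ring⟩
  · exact Or.inr ⟨m, by push_cast; ring⟩

theorem not_two_pow_succ_dvd_two_pow {N j : ℕ} (hj : j < N) :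
    ¬ (2 : ZMod (2 ^ N)) ^ (j + 1) ∣ 2 ^ j := by
  rintro ⟨x, hx⟩
  have h : ((2 ^ (N - 1) : ℕ) : ZMod (2 ^ N)) = 0 := by
    have e : N - 1 = N - 1 - j + j := by omega
    have e' : N = N - 1 - j + (j + 1) := by omega
    push_cast
    rw [e, pow_add, hx, ← mul_assoc, ← pow_add, ← e', two_pow_self_eq_zero, zero_mul]
  rw [ZMod.natCast_eq_zero_iff, Nat.pow_dvd_pow_iff_le_right (by norm_num)] at h
  omega

theorem not_two_dvd_one {N : ℕ} (hN : 1 ≤ N) : ¬ (2 : ZMod (2 ^ N)) ∣ 1 := by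
  simpa using not_two_pow_succ_dvd_two_pow (j := 0) hN

theorem two_dvd_unit_sub_one {N : ℕ} (hN : 1 ≤ N) (u : (ZMod (2 ^ N))ˣ) :
    (2 : ZMod (2 ^ N)) ∣ u - 1 :=
  (two_dvd_or_two_dvd_sub_one (u : ZMod (2 ^ N))).resolve_left fun h =>
    not_two_dvd_one hN (h.trans u.isUnit.dvd)

theorem eq_zero_or_eq_two_pow_of_two_mul_eq_zero {N : ℕ} (hN : 1 ≤ N) {x : ZMod (2 ^ N)}
    (h : 2 * x = 0) : x = 0 ∨ x = 2 ^ (N - 1) := by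
  obtain ⟨y, rfl⟩ := two_pow_dvd_of_two_pow_mul_eq_zero (j := 1) hN (by simpa using h)
  have h0 : (2 : ZMod (2 ^ N)) ^ (N - 1) * 2 = 0 := by
    rw [← pow_succ, Nat.sub_add_cancel hN, two_pow_self_eq_zero]
  rcases two_dvd_or_two_dvd_sub_one y with ⟨z, rfl⟩ | ⟨z, hz⟩
  · left; linear_combination z * h0
  · right; linear_combination 2 ^ (N - 1) * hz + z * h0

/-- Every unit modulo `2 ^ N` is congruent to `1` modulo `4` up to sign. -/
theorem four_dvd_unit_sub_one_or {N : ℕ} (hN : 1 ≤ N) (u : (ZMod (2 ^ N))ˣ) :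
    (4 : ZMod (2 ^ N)) ∣ u - 1 ∨ (4 : ZMod (2 ^ N)) ∣ -u - 1 := by
  obtain ⟨y, hy⟩ := two_dvd_unit_sub_one hN u
  rcases two_dvd_or_two_dvd_sub_one y with ⟨z, rfl⟩ | ⟨z, hz⟩
  · exact Or.inl ⟨z, by linear_combination hy⟩
  · exact Or.inr ⟨-z - 1, by linear_combination -hy - 2 * hz⟩

theorem not_four_dvd_two {N : ℕ} (hN : 2 ≤ N) : ¬ (4 : ZMod (2 ^ N)) ∣ 2 := by
  have := not_two_pow_succ_dvd_two_pow (N := N) (j := 1) hN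
  norm_num at this
  exact this

theorem pow_two_pow_eq {N k : ℕ} (hk : 2 ≤ k) {t a : ZMod (2 ^ N)} (ht : t = 1 + 2 ^ k * a)
    (ha : 2 ∣ a - 1) (i : ℕ) : ∃ b, t ^ 2 ^ i = 1 + 2 ^ (k + i) * b ∧ 2 ∣ b - 1 := by
  induction i with
  | zero => exact ⟨a, by simpa using ht, ha⟩
  | succ i ih =>
    obtain ⟨b, hb, c, hc⟩ := ih
    obtain ⟨l, rfl⟩ := Nat.exists_eq_add_of_le hk
    refine ⟨b + 2 ^ (l + i + 1) * b ^ 2, ?_, c + 2 ^ (l + i) * b ^ 2, ?_⟩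
    · rw [pow_succ 2 i, pow_mul, hb]; ring
    · linear_combination hc

/-- If `t = 1 + 2 ^ k * a` with `k ≥ 2` and `a` odd, then the powers of `t` exhaust the units
congruent to `1` modulo `2 ^ k`. -/
theorem mem_zpowers_of_two_pow_dvd_sub_one {N k : ℕ} (hk : 2 ≤ k) {t : (ZMod (2 ^ N))ˣ}
    {a : ZMod (2 ^ N)} (ht : (t : ZMod (2 ^ N)) = 1 + 2 ^ k * a) (ha : 2 ∣ a - 1) (d : ℕ) :
    ∀ j, k ≤ j → N ≤ j + d → ∀ g : (ZMod (2 ^ N))ˣ, (2 : ZMod (2 ^ N)) ^ j ∣ g - 1 →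
      g ∈ Subgroup.zpowers t := by
  induction d with
  | zero =>
    rintro j hkj hj g ⟨x, hx⟩
    have h1 : g = 1 := by
      ext
      rw [show j = N + (j - N) by omega, pow_add, two_pow_self_eq_zero] at hx
      rw [Units.val_one]
      linear_combination hx
    rw [h1]
    exact one_mem _
  | succ d ih =>
    rintro j hkj hj g ⟨x, hx⟩
    rcases two_dvd_or_two_dvd_sub_one x with ⟨y, rfl⟩ | ⟨y, hy⟩
    · exact ih (j + 1) (by omega) (by omega) g ⟨y, by rw [hx]; ring⟩
    · obtain ⟨b, hb, c, hc⟩ := pow_two_pow_eq hk ht ha (j - k)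
      rw [Nat.add_sub_cancel' hkj] at hb
      have hj2 : (2 : ZMod (2 ^ N)) ^ j = 2 * 2 ^ (j - 1) := by
        rw [← pow_succ', Nat.sub_add_cancel (by omega)]
      have hp : t ^ 2 ^ (j - k) ∈ Subgroup.zpowers t := Subgroup.npow_mem_zpowers t _
      refine (Subgroup.mul_mem_cancel_right _ hp).1 (ih (j + 1) (by omega) (by omega) _
        ⟨y + c + 1 + 2 ^ (j - 1) * x * b, ?_⟩)
      rw [Units.val_mul, Units.val_pow_eq_pow_val, hb, pow_succ]
      linear_combination (1 + 2 ^ j * b) * hx + 2 ^ j * hy + 2 ^ j * hc + 2 ^ j * x * b * hj2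

end ZMod

namespace IsCocycle

variable {n : ℕ} {G : Subgroup (ZMod n)ˣ} {f f' : G → ZMod n}

theorem map_one (hf : IsCocycle G f) : f 1 = 0 := by
  simpa using hf 1 1

theorem add (hf : IsCocycle G f) (hf' : IsCocycle G f') : IsCocycle G (f + f') := by
  intro g h
  simp only [Pi.add_apply, hf g h, hf' g h]
  ring

theorem sub (hf : IsCocycle G f) (hf' : IsCocycle G f') : IsCocycle G (f - f') := by
  intro g h
  simp only [Pi.sub_apply, hf g h, hf' g h]
  ring

/-- The elements at which a cocycle vanishes form a subgroup. -/
def zeros (hf : IsCocycle G f) : Subgroup G where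
  carrier := {g | f g = 0}
  one_mem' := hf.map_one
  mul_mem' {g h} hg hh := by
    simp only [Set.mem_ofPred_eq] at hg hh ⊢
    simp [hf g h, hg, hh]
  inv_mem' {g} hg := by
    simp only [Set.mem_ofPred_eq] at hg ⊢
    simpa [hf.map_one, hg] using (hf g⁻¹ g).symm

/-- Twice a cocycle is determined by its value at `-1`, since `-1` commutes with `g`. -/
theorem two_mul_apply (hf : IsCocycle G f) (hG : -1 ∈ G) (g : G) :
    2 * f g = (1 - ((g : (ZMod n)ˣ) : ZMod n)) * f ⟨-1, hG⟩ := by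
  have h1 := hf g ⟨-1, hG⟩
  rw [mul_comm g, hf] at h1
  simp only [Units.val_neg, Units.val_one] at h1
  linear_combination -h1

end IsCocycle

theorem isCocycle_sub_one_mul {n : ℕ} (G : Subgroup (ZMod n)ˣ) (m : ZMod n) :
    IsCocycle G fun g => (((g : (ZMod n)ˣ) : ZMod n) - 1) * m := by
  intro g h
  simp only [Subgroup.coe_mul, Units.val_mul]
  ring

/-- If `-1` and `t` generate `G`, a cocycle vanishing at both is zero. -/
theorem IsCocycle.eq_zero {n : ℕ} {G : Subgroup (ZMod n)ˣ} {f : G → ZMod n} (hf : IsCocycle G f)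
    (hG : -1 ∈ G) {t : G}
    (hgen : ∀ g ∈ G, g ∈ Subgroup.zpowers (t : (ZMod n)ˣ) ∨ -g ∈ Subgroup.zpowers (t : (ZMod n)ˣ))
    (h1 : f ⟨-1, hG⟩ = 0) (ht : f t = 0) (g : G) : f g = 0 := by
  have key : ∀ g : G, (g : (ZMod n)ˣ) ∈ Subgroup.zpowers (t : (ZMod n)ˣ) → f g = 0 := by
    rintro g ⟨m, hm⟩
    have : t ^ m ∈ hf.zeros := zpow_mem (show t ∈ hf.zeros from ht) m
    rwa [show t ^ m = g from Subtype.ext (by simpa using hm)] at this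
  rcases hgen g g.2 with h | h
  · exact key g h
  · have h' := hf ⟨-1, hG⟩ (⟨-1, hG⟩ * g)
    rw [h1, key (⟨-1, hG⟩ * g) (by simpa using h), ← mul_assoc] at h'
    simpa [show (⟨-1, hG⟩ * ⟨-1, hG⟩ : G) = 1 from Subtype.ext (by simp)] using h'

/-- The case in which `1` is the only element of `G` congruent to `1` modulo `4`, that is,
`G = {1, -1}`. -/
theorem exists_cocycle_of_trivial {N : ℕ} (hN : 3 ≤ N) (G : Subgroup (ZMod (2 ^ N))ˣ)
    (hG : (-1 : (ZMod (2 ^ N))ˣ) ∈ G)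
    (h : ∀ g ∈ G, (4 : ZMod (2 ^ N)) ∣ (g : ZMod (2 ^ N)) - 1 → g = 1) :
    ∃ f₀ : G → ZMod (2 ^ N), IsCocycle G f₀ ∧ ¬ IsCoboundary G f₀ ∧
      ∀ f : G → ZMod (2 ^ N), IsCocycle G f →
        (IsCoboundary G f ∨ IsCoboundary G (f - f₀)) := by
  classical
  set e : G := ⟨-1, hG⟩ with he
  have cases : ∀ g : G, g = 1 ∨ g = e := by
    intro g
    rcases ZMod.four_dvd_unit_sub_one_or (by omega) (g : (ZMod (2 ^ N))ˣ) with h4 | h4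
    · exact Or.inl (Subtype.ext (h g g.2 h4))
    · refine Or.inr (Subtype.ext ?_)
      have := h (-1 * g) (mul_mem hG g.2) (by simpa using h4)
      rw [neg_one_mul] at this
      simp [he, ← this]
  have hne : e ≠ 1 := by
    intro h1
    have h2 : ((e : (ZMod (2 ^ N))ˣ) : ZMod (2 ^ N)) = 1 := by rw [h1]; simp
    rw [he, Units.val_neg, Units.val_one] at h2
    exact ZMod.not_four_dvd_two (N := N) (by omega) ⟨0, by linear_combination -h2⟩
  have hee : e * e = 1 := Subtype.ext (by simp [he])
  have hev : ((e : (ZMod (2 ^ N))ˣ) : ZMod (2 ^ N)) = -1 := by simp [he]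
  have hcob : ∀ f : G → ZMod (2 ^ N), IsCocycle G f → 2 ∣ f e → IsCoboundary G f := by
    rintro f hf ⟨b, hb⟩
    refine ⟨-b, fun g => ?_⟩
    rcases cases g with rfl | rfl
    · simp [hf.map_one]
    · rw [hb, hev]; ring
  have hf₀ : IsCocycle G fun g => if g = 1 then 0 else 1 := by
    intro g h
    rcases cases g with rfl | rfl <;> rcases cases h with rfl | rfl <;> simp [hne, hee, hev]
  refine ⟨_, hf₀, ?_, fun f hf => ?_⟩
  · rintro ⟨m, hm⟩
    have := hm e
    simp only [if_neg hne, hev] at this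
    exact ZMod.not_two_dvd_one (N := N) (by omega) ⟨-m, by linear_combination this⟩
  · rcases ZMod.two_dvd_or_two_dvd_sub_one (f e) with h2 | h2
    · exact Or.inl (hcob f hf h2)
    · exact Or.inr (hcob _ (hf.sub hf₀) (by simpa [hne] using h2))

/-- The case in which `G` contains a nontrivial element congruent to `1` modulo `4`. -/
theorem exists_cocycle_of_nontrivial {N : ℕ} (hN : 3 ≤ N) (G : Subgroup (ZMod (2 ^ N))ˣ)
    (hG : (-1 : (ZMod (2 ^ N))ˣ) ∈ G)
    (h : ∃ g ∈ G, (4 : ZMod (2 ^ N)) ∣ (g : ZMod (2 ^ N)) - 1 ∧ g ≠ 1) :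
    ∃ f₀ : G → ZMod (2 ^ N), IsCocycle G f₀ ∧ ¬ IsCoboundary G f₀ ∧
      ∀ f : G → ZMod (2 ^ N), IsCocycle G f →
        (IsCoboundary G f ∨ IsCoboundary G (f - f₀)) := by
  classical
  -- `k` is the least 2-adic valuation of `t - 1` over the `t ∈ G` congruent to `1` modulo `4`
  have hex : ∃ j, ∃ t ∈ G, (4 : ZMod (2 ^ N)) ∣ (t : ZMod (2 ^ N)) - 1 ∧
      ¬ (2 : ZMod (2 ^ N)) ^ (j + 1) ∣ (t : ZMod (2 ^ N)) - 1 := by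
    obtain ⟨g, hg, h4, h1⟩ := h
    refine ⟨N - 1, g, hg, h4, fun hd => h1 ?_⟩
    rw [Nat.sub_add_cancel (by omega), ZMod.two_pow_self_eq_zero, zero_dvd_iff, sub_eq_zero] at hd
    exact Units.ext hd
  obtain ⟨k, ⟨t, htG, ht4, htk⟩, hmin⟩ :
      ∃ k, (∃ t ∈ G, (4 : ZMod (2 ^ N)) ∣ (t : ZMod (2 ^ N)) - 1 ∧
        ¬ (2 : ZMod (2 ^ N)) ^ (k + 1) ∣ (t : ZMod (2 ^ N)) - 1) ∧
      ∀ j < k, ¬ ∃ t ∈ G, (4 : ZMod (2 ^ N)) ∣ (t : ZMod (2 ^ N)) - 1 ∧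
        ¬ (2 : ZMod (2 ^ N)) ^ (j + 1) ∣ (t : ZMod (2 ^ N)) - 1 :=
    ⟨Nat.find hex, Nat.find_spec hex, fun j hj => Nat.find_min hex hj⟩
  have hk2 : 2 ≤ k := by
    by_contra hk
    refine htk (dvd_trans (pow_dvd_pow 2 (show k + 1 ≤ 2 by omega)) ?_)
    norm_num
    exact ht4
  have hkN : k + 1 ≤ N := by
    by_contra hk
    obtain ⟨g, hg, h4, h1⟩ := h
    refine hmin (N - 1) (by omega) ⟨g, hg, h4, fun hd => h1 ?_⟩
    rw [Nat.sub_add_cancel (by omega), ZMod.two_pow_self_eq_zero, zero_dvd_iff, sub_eq_zero] at hd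
    exact Units.ext hd
  have hdvd : ∀ g ∈ G, (4 : ZMod (2 ^ N)) ∣ (g : ZMod (2 ^ N)) - 1 →
      (2 : ZMod (2 ^ N)) ^ k ∣ (g : ZMod (2 ^ N)) - 1 := by
    intro g hg h4
    by_contra hd
    exact hmin (k - 1) (by omega) ⟨g, hg, h4, by rwa [Nat.sub_add_cancel (by omega)]⟩
  obtain ⟨a, ha⟩ := hdvd t htG ht4
  have hta : (t : ZMod (2 ^ N)) = 1 + 2 ^ k * a := by linear_combination ha
  have ha1 : 2 ∣ a - 1 := (ZMod.two_dvd_or_two_dvd_sub_one a).resolve_left fun ⟨y, hy⟩ =>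
    htk ⟨y, by rw [ha, hy]; ring⟩
  have hgen : ∀ g ∈ G, g ∈ Subgroup.zpowers t ∨ -g ∈ Subgroup.zpowers t := by
    intro g hg
    have key : ∀ g ∈ G, (4 : ZMod (2 ^ N)) ∣ (g : ZMod (2 ^ N)) - 1 → g ∈ Subgroup.zpowers t :=
      fun g hg h4 => ZMod.mem_zpowers_of_two_pow_dvd_sub_one hk2 hta ha1 N k le_rfl (by omega) g
        (hdvd g hg h4)
    rcases ZMod.four_dvd_unit_sub_one_or (by omega) g with h4 | h4
    · exact Or.inl (key g hg h4)
    · exact Or.inr (key (-g) (by simpa using mul_mem hG hg) (by simpa using h4))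
  have hN0 : (2 : ZMod (2 ^ N)) * 2 ^ (N - 1) = 0 := by
    rw [← pow_succ', Nat.sub_add_cancel (by omega), ZMod.two_pow_self_eq_zero]
  -- the sign making an element congruent to `1` modulo `4`
  have hsign : ∀ g : G, ∃ s : ZMod (2 ^ N), (s = 1 ∨ s = -1) ∧
      4 ∣ s * ((g : (ZMod (2 ^ N))ˣ) : ZMod (2 ^ N)) - 1 := by
    intro g
    rcases ZMod.four_dvd_unit_sub_one_or (by omega) (g : (ZMod (2 ^ N))ˣ) with h4 | h4
    · exact ⟨1, Or.inl rfl, by simpa using h4⟩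
    · exact ⟨-1, Or.inr rfl, by simpa using h4⟩
  choose s hs hs4 using hsign
  have hs_unique : ∀ (g : G) (r : ZMod (2 ^ N)), (r = 1 ∨ r = -1) →
      4 ∣ r * ((g : (ZMod (2 ^ N))ˣ) : ZMod (2 ^ N)) - 1 → s g = r := by
    rintro g r hr ⟨y, hy⟩
    obtain ⟨z, hz⟩ := hs4 g
    have h42 := ZMod.not_four_dvd_two (N := N) (by omega)
    rcases hs g with h1 | h1 <;> rcases hr with h2 | h2 <;> rw [h1] at hz ⊢ <;> rw [h2] at hy ⊢
    · exact absurd ⟨-y - z, by linear_combination -hy - hz⟩ h42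
    · exact absurd ⟨-y - z, by linear_combination -hy - hz⟩ h42
  have hs_mul : ∀ g h : G, s (g * h) = s g * s h := by
    intro g h
    refine hs_unique _ _ ?_ ?_
    · rcases hs g with h1 | h1 <;> rcases hs h with h2 | h2 <;> simp [h1, h2]
    · obtain ⟨y, hy⟩ := hs4 g
      obtain ⟨z, hz⟩ := hs4 h
      refine ⟨y * (1 + 4 * z) + z, ?_⟩
      simp only [Subgroup.coe_mul, Units.val_mul]
      linear_combination (s h * ((h : (ZMod (2 ^ N))ˣ) : ZMod (2 ^ N))) * hy + (1 + 4 * y) * hz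
  have hsdvd : ∀ g : G,
      (2 : ZMod (2 ^ N)) ^ k ∣ s g * ((g : (ZMod (2 ^ N))ˣ) : ZMod (2 ^ N)) - 1 := by
    intro g
    have h4 := hs4 g
    rcases hs g with h1 | h1 <;> rw [h1] at h4 ⊢
    · simpa using hdvd g g.2 (by simpa using h4)
    · simpa using hdvd (-g) (by simpa using mul_mem hG g.2) (by simpa using h4)
  set f₀ : G → ZMod (2 ^ N) := fun g =>
    2 ^ (N - 1 - k) * (s g * ((g : (ZMod (2 ^ N))ˣ) : ZMod (2 ^ N)) - 1) with hf₀_def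
  have hf₀_two : ∀ g, 2 * f₀ g = 0 := by
    intro g
    obtain ⟨y, hy⟩ := hsdvd g
    have e : (2 : ZMod (2 ^ N)) ^ (N - 1) = 2 ^ (N - 1 - k) * 2 ^ k := by
      rw [← pow_add]; congr 1; omega
    simp only [hf₀_def, hy]
    linear_combination y * hN0 - 2 * y * e
  have hf₀ : IsCocycle G f₀ := by
    intro g h
    obtain ⟨y, hy⟩ := hs4 h
    obtain ⟨z, hz⟩ := ZMod.two_dvd_unit_sub_one (by omega) (g : (ZMod (2 ^ N))ˣ)
    have h1 := hf₀_two g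
    have h2 := hf₀_two h
    simp only [hf₀_def, hs_mul, Subgroup.coe_mul, Units.val_mul] at h1 h2 ⊢
    set u := ((g : (ZMod (2 ^ N))ˣ) : ZMod (2 ^ N))
    set v := ((h : (ZMod (2 ^ N))ˣ) : ZMod (2 ^ N))
    linear_combination 2 * y * h1 - z * h2 + 2 ^ (N - 1 - k) * (s g * u - 1) * hy
      - 2 ^ (N - 1 - k) * (s h * v - 1) * hz
  set e : G := ⟨-1, hG⟩ with he
  have hev : ((e : (ZMod (2 ^ N))ˣ) : ZMod (2 ^ N)) = -1 := by simp [he]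
  have hf₀e : f₀ e = 0 := by
    simp only [hf₀_def, hev, hs_unique e (-1) (Or.inr rfl) (by simp [hev])]
    ring
  have hf₀t : f₀ ⟨t, htG⟩ ≠ 0 := by
    intro h0
    simp only [hf₀_def, hs_unique ⟨t, htG⟩ 1 (Or.inl rfl) (by simpa using ht4), one_mul] at h0
    have := ZMod.two_pow_dvd_of_two_pow_mul_eq_zero (by omega) h0
    rw [show N - (N - 1 - k) = k + 1 by omega] at this
    exact htk this
  refine ⟨f₀, hf₀, ?_, fun f hf => ?_⟩
  · rintro ⟨m, hm⟩
    have h1 := hm e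
    rw [hf₀e, hev] at h1
    obtain ⟨y, hy⟩ := ZMod.two_dvd_unit_sub_one (by omega) t
    apply hf₀t
    rw [hm ⟨t, htG⟩]
    linear_combination m * hy + y * h1
  · have hfe : 2 ∣ f e := by
      obtain ⟨b, hb, c, hc⟩ := ZMod.pow_two_pow_eq hk2 hta ha1 (N - 1 - k)
      rw [show k + (N - 1 - k) = N - 1 by omega] at hb
      set w : G := ⟨t, htG⟩ ^ 2 ^ (N - 1 - k) with hw
      have hwv : ((w : (ZMod (2 ^ N))ˣ) : ZMod (2 ^ N)) = 1 + 2 ^ (N - 1) := by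
        simp only [hw, Subgroup.coe_pow, Units.val_pow_eq_pow_val, hb]
        linear_combination 2 ^ (N - 1) * hc + c * hN0
      obtain ⟨l, rfl⟩ := Nat.exists_eq_add_of_le hN
      rw [show 3 + l - 1 = l + 2 by omega] at hN0 hwv
      have hww : w * w = 1 := by
        ext
        simp only [Subgroup.coe_mul, Units.val_mul, hwv, Subgroup.coe_one, Units.val_one]
        linear_combination (1 + 2 ^ (l + 1)) * hN0
      have h1 := hf w w
      rw [hww, hf.map_one, hwv] at h1
      have h2 := hf.two_mul_apply hG w
      rw [hwv] at h2
      have h3 : 2 ^ (l + 2) * f e = 0 := by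
        linear_combination h2 + (1 - 2 ^ (l + 1)) * h1 - 2 ^ l * f w * hN0
      simpa [show 3 + l - (l + 2) = 1 by omega] using
        ZMod.two_pow_dvd_of_two_pow_mul_eq_zero (by omega) h3
    obtain ⟨b, hb⟩ := hfe
    have hF := hf.add (isCocycle_sub_one_mul G b)
    set F := f + fun g : G => (((g : (ZMod (2 ^ N))ˣ) : ZMod (2 ^ N)) - 1) * b with hF_def
    have hFe : F e = 0 := by
      simp only [hF_def, Pi.add_apply, hev, hb]
      ring
    have hFt : 2 * F ⟨t, htG⟩ = 0 := by
      have := hF.two_mul_apply hG ⟨t, htG⟩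
      rwa [hFe, mul_zero] at this
    have hf₀t' := (ZMod.eq_zero_or_eq_two_pow_of_two_mul_eq_zero (by omega)
      (hf₀_two ⟨t, htG⟩)).resolve_left hf₀t
    rcases ZMod.eq_zero_or_eq_two_pow_of_two_mul_eq_zero (by omega) hFt with h0 | h0
    · refine Or.inl ⟨-b, fun g => ?_⟩
      have := hF.eq_zero hG hgen hFe h0 g
      simp only [hF_def, Pi.add_apply] at this
      linear_combination this
    · refine Or.inr ⟨-b, fun g => ?_⟩
      have := (hF.sub hf₀).eq_zero hG (t := ⟨t, htG⟩) hgen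
        (by rw [Pi.sub_apply, hFe, hf₀e, sub_zero])
        (by rw [Pi.sub_apply, h0, hf₀t', sub_self]) g
      simp only [hF_def, Pi.add_apply, Pi.sub_apply] at this ⊢
      linear_combination this

/-- Let `N ≥ 3` and let `G ≤ (ℤ/2^Nℤ)ˣ` contain the class of `−1`, acting on `M = ℤ/2^Nℤ` by
multiplication. Then `H¹(G, M) ≃ ℤ/2ℤ`: the quotient of 1-cocycles by 1-coboundaries has exactly
two elements, i.e. there is a 1-cocycle `f₀` that is not a coboundary, and every 1-cocycle is,
modulo coboundaries, equal to `0` or to `f₀`. -/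
theorem stmt_2 (N : ℕ) (hN : 3 ≤ N) (G : Subgroup (ZMod (2 ^ N))ˣ)
    (hG : (-1 : (ZMod (2 ^ N))ˣ) ∈ G) :
    ∃ f₀ : G → ZMod (2 ^ N), IsCocycle G f₀ ∧ ¬ IsCoboundary G f₀ ∧
      ∀ f : G → ZMod (2 ^ N), IsCocycle G f →
        (IsCoboundary G f ∨ IsCoboundary G (f - f₀)) := by
  by_cases h : ∀ g ∈ G, (4 : ZMod (2 ^ N)) ∣ (g : ZMod (2 ^ N)) - 1 → g = 1
  · exact exists_cocycle_of_trivial hN G hG h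
  · push Not at h
    exact exists_cocycle_of_nontrivial hN G hG h
end

section
/- Let k = 𝔽₂(t) be the rational function field over the field with two elements and let E be the elliptic curve over k given by y² + xy = x³ + t⁸x² + (t¹⁶+1)/t⁸. Then E(k) is a finite group; i.e., E has Mordell–Weil rank 0 over k. -/
open WeierstrassCurve WeierstrassCurve.Affine

open Polynomial

instance subsingleton_units_polynomial_zmod_two : Subsingleton (ZMod 2)[X]ˣ where
  allEq u v := by
    have key : ∀ w : (ZMod 2)[X]ˣ, (w : (ZMod 2)[X]) = 1 := fun w => by
      obtain ⟨r, hr, h⟩ := Polynomial.isUnit_iff.1 w.isUnit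
      have : ∀ a : ZMod 2, IsUnit a → a = 1 := by decide
      rw [← h, this r hr, C_1]
    exact Units.ext ((key u).trans (key v).symm)

theorem monic_of_ne_zero {p : (ZMod 2)[X]} (hp : p ≠ 0) : p.Monic := by
  have : ∀ a : ZMod 2, a ≠ 0 → a = 1 := by decide
  exact this _ (leadingCoeff_ne_zero.2 hp)

theorem natDegree_sq_add_mul_of_lt {p q : (ZMod 2)[X]} (h : q.natDegree < p.natDegree) :
    (p ^ 2 + p * q).natDegree = 2 * p.natDegree := by
  rw [natDegree_add_eq_left_of_natDegree_lt, natDegree_pow]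
  rw [natDegree_pow]
  exact natDegree_mul_le.trans_lt (by omega)

/-- The `x`-coordinate `A / (X * D) ^ 2` of a point of `y² + xy = x³ + tx² + (t + 1)² / t` has a
pole at infinity. -/
theorem two_mul_natDegree_lt {A C D : (ZMod 2)[X]} (hA : A ≠ 0) (hD : D ≠ 0)
    (h : C ^ 2 + C * A * (X * D) =
      A ^ 3 + X * A ^ 2 * (X * D) ^ 2 + (X + 1) ^ 2 * X ^ 5 * D ^ 6) :
    2 * (X * D).natDegree < A.natDegree := by
  have hX1 : (X + 1 : (ZMod 2)[X]).Monic := monic_X_add_C 1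
  have hX1' : (X + 1 : (ZMod 2)[X]).natDegree = 1 := natDegree_X_add_C 1
  have hB : (X * D).natDegree = D.natDegree + 1 := natDegree_X_mul hD
  have hB0 : X * D ≠ 0 := mul_ne_zero X_ne_zero hD
  have hAB : (A * (X * D)).natDegree = A.natDegree + (D.natDegree + 1) := by
    rw [natDegree_mul hA hB0, hB]
  rw [hB]
  rw [mul_assoc C] at h
  by_contra! hle
  rcases hle.lt_or_eq with hlt | heq
  · have hT : ((X + 1) ^ 2 * X ^ 5 * D ^ 6).natDegree = 7 + 6 * D.natDegree := by
      rw [natDegree_mul (by simp [hX1.ne_zero]) (by simp [hD]),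
        natDegree_mul (by simp [hX1.ne_zero]) (by simp), natDegree_pow, natDegree_pow,
        natDegree_pow, natDegree_X, hX1']
    have hlow : (A ^ 3 + X * A ^ 2 * (X * D) ^ 2).natDegree ≤ 6 + 6 * D.natDegree := by
      refine natDegree_add_le_of_degree_le (natDegree_pow_le.trans (by omega)) ?_
      rw [natDegree_mul (by simp [hA]) (by simp [hD]), natDegree_X_mul (by simp [hA]),
        natDegree_pow, natDegree_pow, hB]
      omega
    have hdeg := congrArg natDegree h
    rw [natDegree_add_eq_right_of_natDegree_lt (p := A ^ 3 + _) (by omega), hT] at hdeg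
    rcases lt_or_ge (A * (X * D)).natDegree C.natDegree with hC | hC
    · rw [natDegree_sq_add_mul_of_lt hC] at hdeg
      omega
    · have : (C ^ 2 + C * (A * (X * D))).natDegree ≤ 2 * (A * (X * D)).natDegree :=
        natDegree_add_le_of_degree_le (natDegree_pow_le.trans (by omega))
          (natDegree_mul_le.trans (by omega))
      omega
  · have hU : (A - (X * D) ^ 2).natDegree ≤ 2 * D.natDegree + 1 := by
      have hd : A.degree = ((X * D) ^ 2).degree := by
        rw [degree_eq_natDegree hA, degree_eq_natDegree (pow_ne_zero 2 hB0), natDegree_pow, hB,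
          heq]
      have := degree_sub_lt_left hd hA (by
        rw [(monic_of_ne_zero hA).leadingCoeff,
          (monic_of_ne_zero (pow_ne_zero 2 hB0)).leadingCoeff])
      rw [degree_eq_natDegree hA, heq] at this
      rcases eq_or_ne (A - (X * D) ^ 2) 0 with h0 | h0
      · rw [h0, natDegree_zero]; omega
      · have := (natDegree_lt_iff_degree_lt h0).2 this
        omega
    have hrhs : A ^ 3 + X * A ^ 2 * (X * D) ^ 2 + (X + 1) ^ 2 * X ^ 5 * D ^ 6 =
        A ^ 3 + (X * (X * D) ^ 2 * (A - (X * D) ^ 2) ^ 2 + X ^ 5 * D ^ 6) := by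
      have h2 : (2 : (ZMod 2)[X]) = 0 := CharTwo.two_eq_zero
      linear_combination (X * (X * D) ^ 4 * A + X ^ 6 * D ^ 6) * h2
    have hlow : (X * (X * D) ^ 2 * (A - (X * D) ^ 2) ^ 2 + X ^ 5 * D ^ 6).natDegree <
        6 * (D.natDegree + 1) := by
      refine Nat.lt_of_le_of_lt (natDegree_add_le_of_degree_le (n := 6 * D.natDegree + 5) ?_ ?_)
        (by omega)
      · refine natDegree_mul_le.trans ?_
        rw [natDegree_X_mul (pow_ne_zero 2 hB0), natDegree_pow, natDegree_pow, hB]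
        omega
      · rw [natDegree_mul (by simp) (by simp [hD]), natDegree_pow, natDegree_pow, natDegree_X]
        omega
    rw [hrhs] at h
    rcases lt_or_ge (A * (X * D)).natDegree C.natDegree with hC | hC
    · have hdeg := congrArg natDegree h
      rw [natDegree_sq_add_mul_of_lt hC] at hdeg
      have := natDegree_add_le_of_degree_le (p := A ^ 3) (n := 6 * (D.natDegree + 1))
        (natDegree_pow_le.trans (by omega)) hlow.le
      omega
    · have hc := congrArg (coeff · (6 * (D.natDegree + 1))) h
      beta_reduce at hc
      rw [coeff_add, coeff_add, coeff_eq_zero_of_natDegree_lt hlow] at hc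
      have c1 : (C ^ 2).coeff (6 * (D.natDegree + 1)) = C.coeff (3 * (D.natDegree + 1)) ^ 2 := by
        rw [← coeff_pow_of_natDegree_le (by omega)]
        congr 1; omega
      have c2 : (A ^ 3).coeff (6 * (D.natDegree + 1)) = 1 := by
        have := (monic_of_ne_zero (pow_ne_zero 3 hA)).coeff_natDegree
        rw [natDegree_pow, heq] at this
        rw [← this]
        congr 1; omega
      have c3 : (C * (A * (X * D))).coeff (6 * (D.natDegree + 1)) =
          C.coeff (3 * (D.natDegree + 1)) := by
        have hm := (monic_of_ne_zero (mul_ne_zero hA hB0)).coeff_natDegree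
        have e : 6 * (D.natDegree + 1) = 3 * (D.natDegree + 1) + (A * (X * D)).natDegree := by
          omega
        rw [e, coeff_mul_add_eq_of_natDegree_le (by omega) le_rfl, hm, mul_one]
      rw [c1, c2, c3] at hc
      have : ∀ a : ZMod 2, a ^ 2 + a ≠ 1 + 0 := by decide
      exact this _ hc

/-- The `x`-coordinate `A / M` of a point of `y² + xy = x³ + tx² + (t + 1)² / t` has square
denominator, divisible by `t`; here `C / N` is the quotient `y / x`. -/
theorem exists_denom_eq_sq {A M C N : (ZMod 2)[X]} (hA : A ≠ 0) (hM : M ≠ 0) (hN : N ≠ 0)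
    (hAM : IsCoprime A M) (hCN : IsCoprime C N)
    (h : (C ^ 2 + C * N) * (X * A ^ 2 * M) =
      N ^ 2 * (X * A ^ 3 + X ^ 2 * A ^ 2 * M + (X + 1) ^ 2 * M ^ 3)) :
    ∃ D, M = (X * D) ^ 2 ∧ N ∣ A * (X * D) := by
  have hcop : IsCoprime (N ^ 2) (C ^ 2 + C * N) := by
    have : C ^ 2 + C * N = C * (C + N * 1) := by ring
    rw [this]
    refine IsCoprime.pow_left (hCN.symm.mul_right ?_)
    exact (IsCoprime.add_mul_left_left hCN 1).symm
  obtain ⟨L, hL⟩ : N ^ 2 ∣ X * A ^ 2 * M := hcop.dvd_of_dvd_mul_left ⟨_, h⟩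
  have hK : (C ^ 2 + C * N) * L = X * A ^ 3 + X ^ 2 * A ^ 2 * M + (X + 1) ^ 2 * M ^ 3 := by
    apply mul_left_cancel₀ (pow_ne_zero 2 hN)
    rw [← h, hL]; ring
  have hXM : (X : (ZMod 2)[X]) ∣ M := by
    by_contra hXM
    have hM0 : M.coeff 0 ≠ 0 := fun h0 => hXM (X_dvd_iff.2 h0)
    have hL0 : L.coeff 0 ≠ 0 := by
      intro h0
      have := congrArg (coeff · 0) hK
      simp [coeff_zero_eq_eval_zero] at this hM0 h0
      simp [h0] at this
      exact hM0 (pow_eq_zero_iff three_ne_zero |>.1 this.symm)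
    have hLne : L ≠ 0 := by rintro rfl; simp at hL0
    have := congrArg natTrailingDegree hL
    rw [natTrailingDegree_mul (by simp [hA]) hM, natTrailingDegree_mul X_ne_zero (by simp [hA]),
      natTrailingDegree_mul (by simp [hN]) hLne, pow_two, pow_two, natTrailingDegree_mul hA hA,
      natTrailingDegree_mul hN hN, natTrailingDegree_X,
      natTrailingDegree_eq_zero.2 (.inr hM0), natTrailingDegree_eq_zero.2 (.inr hL0)] at this
    omega
  obtain ⟨M', rfl⟩ := hXM
  have h1 : (C ^ 2 + C * N) * (A ^ 2 * (X * M')) = N ^ 2 * (A ^ 3 + (X * M') *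
      (X * A ^ 2 + (X + 1) ^ 2 * M' * (X * M'))) := by
    apply mul_left_cancel₀ (X_ne_zero (R := ZMod 2))
    linear_combination h
  obtain ⟨L, hL⟩ : N ^ 2 ∣ A ^ 2 * (X * M') := hcop.dvd_of_dvd_mul_left ⟨_, h1⟩
  have hMK : IsCoprime (X * M') (A ^ 3 + (X * M') *
      (X * A ^ 2 + (X + 1) ^ 2 * M' * (X * M'))) :=
    (IsCoprime.add_mul_left_left hAM.pow_left _).symm
  obtain ⟨Q, hQ⟩ : X * M' ∣ N ^ 2 := hMK.dvd_of_dvd_mul_right ⟨(C ^ 2 + C * N) * A ^ 2, by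
    rw [← h1]; ring⟩
  have hQA : Q ∣ A ^ 2 := ⟨L, mul_left_cancel₀ hM (by
    linear_combination hL + L * hQ)⟩
  have hcopMQ : IsCoprime (X * M') Q := (hAM.symm.pow_right (n := 2)).of_isCoprime_of_dvd_right hQA
  obtain ⟨B, hB⟩ := exists_eq_pow_of_mul_eq_pow_of_coprime hcopMQ hQ.symm
  obtain ⟨E, hE⟩ := exists_eq_pow_of_mul_eq_pow_of_coprime hcopMQ.symm ((mul_comm _ _).trans hQ.symm)
  obtain ⟨D, rfl⟩ : (X : (ZMod 2)[X]) ∣ B := prime_X.dvd_of_dvd_pow (hB ▸ dvd_mul_right X M')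
  refine ⟨D, hB, ?_⟩
  rw [← IsIntegrallyClosed.pow_dvd_pow_iff two_ne_zero, hQ, mul_pow, ← hB, mul_comm]
  exact mul_dvd_mul hQA dvd_rfl

/-- Splitting `y / x` into partial fractions solves two Artin–Schreier equations at once: the point
is in the image of Verschiebung. -/
theorem exists_partial_fractions {A C D : (ZMod 2)[X]} (hA : A ≠ 0) (hD : D ≠ 0)
    (hAD : IsCoprime A (X * D))
    (h : C ^ 2 + C * A * (X * D) =
      A ^ 3 + X * A ^ 2 * (X * D) ^ 2 + (X + 1) ^ 2 * X ^ 5 * D ^ 6) :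
    ∃ R S, R ^ 2 + R * A = (X + 1) ^ 2 * X ^ 3 * D ^ 4 ∧
      S ^ 2 + S * (X * D) = A + X * (X * D) ^ 2 := by
  have hdeg := two_mul_natDegree_lt hA hD h
  obtain ⟨a, b, hab⟩ := hAD
  have hmod := EuclideanDomain.mod_add_div (C * b) A
  set R := (C * b) % A with hR
  set q := (C * b) / A
  have hRdeg : R.degree < A.degree := EuclideanDomain.mod_lt _ hA
  obtain ⟨S, hS⟩ : ∃ S, C = R * (X * D) + S * A :=
    ⟨C * a + q * (X * D), by linear_combination -C * hab - X * D * hmod⟩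
  have key : (R ^ 2 + R * A - (X + 1) ^ 2 * X ^ 3 * D ^ 4) * (X * D) ^ 2 =
      A ^ 2 * (A + X * (X * D) ^ 2 - (S ^ 2 + S * (X * D))) := by
    have h2 : (2 : (ZMod 2)[X]) = 0 := CharTwo.two_eq_zero
    rw [hS] at h
    linear_combination h - (R * X * D * S * A) * h2
  have hdvd : A ^ 2 ∣ R ^ 2 + R * A - (X + 1) ^ 2 * X ^ 3 * D ^ 4 :=
    (IsCoprime.pow (⟨a, b, hab⟩ : IsCoprime A (X * D))).dvd_of_dvd_mul_right ⟨_, key⟩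
  have hz : R ^ 2 + R * A - (X + 1) ^ 2 * X ^ 3 * D ^ 4 = 0 := by
    apply eq_zero_of_dvd_of_degree_lt hdvd
    have h1 : (R ^ 2 + R * A).degree < (A ^ 2).degree := by
      have hRA : R.natDegree < A.natDegree := by
        rcases eq_or_ne R 0 with h0 | h0
        · rw [h0, natDegree_zero]; omega
        · exact natDegree_lt_natDegree h0 hRdeg
      apply degree_lt_degree
      rw [natDegree_pow]
      have := natDegree_add_le_of_degree_le (n := 2 * A.natDegree - 1) (p := R ^ 2) (q := R * A)
        (natDegree_pow_le.trans (by omega)) (natDegree_mul_le.trans (by omega))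
      omega
    have h2 : ((X + 1) ^ 2 * X ^ 3 * D ^ 4).degree < (A ^ 2).degree := by
      apply degree_lt_degree
      rw [natDegree_X_mul hD] at hdeg
      have hX1 : (X + 1 : (ZMod 2)[X]).Monic := monic_X_add_C 1
      have hX1' : (X + 1 : (ZMod 2)[X]).natDegree = 1 := natDegree_X_add_C 1
      rw [natDegree_mul (by simp [hX1.ne_zero]) (by simp [hD]),
        natDegree_mul (by simp [hX1.ne_zero]) (by simp), natDegree_pow, natDegree_pow,
        natDegree_pow, natDegree_pow, natDegree_X, hX1']
      omega
    exact (degree_sub_le _ _).trans_lt (max_lt h1 h2)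
  refine ⟨R, S, sub_eq_zero.1 hz, ?_⟩
  rw [hz, zero_mul, eq_comm, mul_eq_zero] at key
  exact (sub_eq_zero.1 (key.resolve_left (pow_ne_zero 2 hA))).symm

theorem exists_sq_factor_of_dvd {A D R : (ZMod 2)[X]}
    (hR : R * (R + A) = (X + 1) ^ 2 * X ^ 3 * D ^ 4) (hc : IsCoprime R (R + A))
    (hX : X ∣ R + A) :
    ∃ m, m ^ 2 * (m ^ 2 + A) = (X + 1) ^ 2 * X ^ 3 * D ^ 4 := by
  obtain ⟨H, hH⟩ := hX
  have hRH : R * H = ((X + 1) * X * D ^ 2) ^ 2 := by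
    apply mul_left_cancel₀ (X_ne_zero (R := ZMod 2))
    rw [hH] at hR
    linear_combination hR
  have hc' : IsCoprime R H := hc.of_isCoprime_of_dvd_right ⟨X, by rw [hH, mul_comm]⟩
  obtain ⟨m, rfl⟩ := exists_eq_pow_of_mul_eq_pow_of_coprime hc' hRH
  exact ⟨m, hR⟩

/-- One of the two preimages under Verschiebung has square `x`-coordinate. -/
theorem exists_sq_factor {A D R S : (ZMod 2)[X]} (hAD : IsCoprime A (X * D))
    (hR : R ^ 2 + R * A = (X + 1) ^ 2 * X ^ 3 * D ^ 4)
    (hS : S ^ 2 + S * (X * D) = A + X * (X * D) ^ 2) :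
    ∃ m, m ^ 2 * (m ^ 2 + A) = (X + 1) ^ 2 * X ^ 3 * D ^ 4 := by
  have hF : ∀ a : ZMod 2, a = 0 ∨ a = 1 := by decide
  have hirr : Irreducible (X + 1 : (ZMod 2)[X]) := by
    rw [← CharTwo.sub_eq_add]
    simpa using irreducible_X_sub_C (1 : ZMod 2)
  have hA1 : IsCoprime A (X + 1) := by
    refine ((hirr.coprime_iff_not_dvd).2 fun hdvd => ?_).symm
    have hA0 : A.eval 1 = 0 := by
      obtain ⟨q, rfl⟩ := hdvd
      simp [CharTwo.add_self_eq_zero]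
    obtain ⟨a, b, hab⟩ := hAD
    have e1 := congrArg (eval 1) hab
    have e2 := congrArg (eval 1) hS
    simp [hA0] at e1 e2
    rcases hF (D.eval 1) with h | h <;> rcases hF (S.eval 1) with h' | h' <;>
      simp [h, h', CharTwo.add_self_eq_zero] at e1 e2
  have hcR : IsCoprime R (R + A) := by
    have h1 : IsCoprime A (R * (R + A)) := by
      have : R * (R + A) = (X + 1) ^ 2 * X ^ 3 * D ^ 4 := by rw [← hR]; ring
      rw [this]
      exact (hA1.pow_right.mul_right hAD.of_mul_right_left.pow_right).mul_right
        hAD.of_mul_right_right.pow_right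
    have := (IsCoprime.add_mul_left_left h1.of_mul_right_left 1).symm
    rwa [mul_one, add_comm] at this
  have hR' : R * (R + A) = (X + 1) ^ 2 * X ^ 3 * D ^ 4 := by rw [← hR]; ring
  have hX : X ∣ R * (R + A) := by
    rw [hR']; exact ⟨(X + 1) ^ 2 * X ^ 2 * D ^ 4, by ring⟩
  rcases prime_X.dvd_or_dvd hX with hX | hX
  · have hRAA : R + A + A = R := by rw [add_assoc, CharTwo.add_self_eq_zero, add_zero]
    refine exists_sq_factor_of_dvd (R := R + A) ?_ ?_ ?_ <;> rw [hRAA]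
    · rw [mul_comm, hR']
    · exact hcR.symm
    · exact hX
  · exact exists_sq_factor_of_dvd hR' hcR hX

/-- The curve `y² + xy = x³ + tx² + (t + 1)² / t` has no affine point over `𝔽₂(t)` with `x ≠ 0`:
halving a point strictly decreases the degree of the denominator of `x`. -/
theorem artinSchreier_ne (x : RatFunc (ZMod 2)) (hx : x ≠ 0) (z : RatFunc (ZMod 2)) :
    z ^ 2 + z ≠ x + RatFunc.X + (RatFunc.X + 1) ^ 2 / RatFunc.X / x ^ 2 := by
  induction hn : x.denom.natDegree using Nat.strong_induction_on generalizing x z with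
  | _ n ih =>
  intro hz
  have hinj := RatFunc.algebraMap_injective (ZMod 2)
  have hne : ∀ p : (ZMod 2)[X], p ≠ 0 → algebraMap _ (RatFunc (ZMod 2)) p ≠ 0 := fun p hp =>
    RatFunc.algebraMap_ne_zero hp
  have hX0 : (RatFunc.X : RatFunc (ZMod 2)) ≠ 0 := RatFunc.X_ne_zero
  have hA : x.num ≠ 0 := RatFunc.num_ne_zero hx
  have hM := x.denom_ne_zero
  have hN := z.denom_ne_zero
  have h : (z.num ^ 2 + z.num * z.denom) * (X * x.num ^ 2 * x.denom) =
      z.denom ^ 2 * (X * x.num ^ 3 + X ^ 2 * x.num ^ 2 * x.denom +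
        (X + 1) ^ 2 * x.denom ^ 3) := by
    apply hinj
    have hA' := hne _ hA
    have hM' := hne _ hM
    have hN' := hne _ hN
    rw [← RatFunc.num_div_denom x, ← RatFunc.num_div_denom z] at hz
    simp only [map_mul, map_add, map_pow, map_one, RatFunc.algebraMap_X]
    field_simp at hz
    linear_combination hz
  obtain ⟨D, hMD, k, hk⟩ := exists_denom_eq_sq hA hM hN x.isCoprime_num_denom
    z.isCoprime_num_denom h
  have hD : D ≠ 0 := by
    rintro rfl
    simp [hM] at hMD
  have hAD : IsCoprime x.num (X * D) :=
    x.isCoprime_num_denom.of_isCoprime_of_dvd_right ⟨X * D, by rw [hMD, pow_two]⟩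
  have hC : (z.num * k) ^ 2 + (z.num * k) * x.num * (X * D) =
      x.num ^ 3 + X * x.num ^ 2 * (X * D) ^ 2 + (X + 1) ^ 2 * X ^ 5 * D ^ 6 := by
    have h0 : X * x.num ^ 2 * (X * D) ^ 2 ≠ 0 := by simp [hA, hD]
    apply mul_left_cancel₀ h0
    rw [hMD] at h
    linear_combination k ^ 2 * h +
      (X * x.num ^ 2 * (X * D) ^ 2 * z.num * k - (x.num * (X * D) + z.denom * k) *
        (X * x.num ^ 3 + X ^ 2 * x.num ^ 2 * (X * D) ^ 2 + (X + 1) ^ 2 * (X * D) ^ 6)) * hk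
  obtain ⟨R, S, hR, hS⟩ := exists_partial_fractions hA hD hAD hC
  obtain ⟨m, hm⟩ := exists_sq_factor hAD hR hS
  have hm0 : m ≠ 0 := by
    rintro rfl
    have hX1 : (X + 1 : (ZMod 2)[X]) ≠ 0 := (monic_X_add_C 1).ne_zero
    simp [hD, hX1] at hm
  have hD' := hne _ hD
  have hm' := hne _ hm0
  refine ih _ ?_ (algebraMap _ _ m / algebraMap _ _ (X * D)) ?_
    (algebraMap _ _ S / algebraMap _ _ (X * D) + algebraMap _ _ m / algebraMap _ _ (X * D)) rfl ?_
  · have h1 := natDegree_le_of_dvd (RatFunc.denom_div_dvd m (X * D)) (mul_ne_zero X_ne_zero hD)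
    have h2 := congrArg natDegree hMD
    rw [natDegree_pow] at h2
    rw [natDegree_X_mul hD] at h1 h2
    omega
  · exact div_ne_zero hm' (hne _ (mul_ne_zero X_ne_zero hD))
  · have hS' := congrArg (algebraMap _ (RatFunc (ZMod 2))) hS
    have hm'' := congrArg (algebraMap _ (RatFunc (ZMod 2))) hm
    simp only [map_mul, map_add, map_pow, map_one, RatFunc.algebraMap_X] at hS' hm'' ⊢
    have h2 : (2 : RatFunc (ZMod 2)) = 0 := CharTwo.two_eq_zero
    generalize algebraMap _ (RatFunc (ZMod 2)) m = m at *
    generalize algebraMap _ (RatFunc (ZMod 2)) D = D at *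
    generalize algebraMap _ (RatFunc (ZMod 2)) S = S at *
    generalize algebraMap _ (RatFunc (ZMod 2)) x.num = A at *
    generalize (RatFunc.X : RatFunc (ZMod 2)) = t at *
    have e1 : (S / (t * D)) ^ 2 + S / (t * D) = A / (t * D) ^ 2 + t := by
      field_simp
      linear_combination hS'
    have e2 : A / (t * D) ^ 2 = (t + 1) ^ 2 / t / (m / (t * D)) ^ 2 - (m / (t * D)) ^ 2 := by
      field_simp
      linear_combination hm''
    linear_combination e1 + e2 + S / (t * D) * (m / (t * D)) * h2

theorem finite_setOf_quadratic {F : Type*} [Field F] (s b : F) :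
    {x : F | x ^ 2 + s * x + b = 0}.Finite := by
  rcases Set.eq_empty_or_nonempty {x : F | x ^ 2 + s * x + b = 0} with h | ⟨x₀, hx₀⟩
  · rw [h]; exact Set.finite_empty
  · refine (Set.toFinite {x₀, -x₀ - s}).subset fun x hx => ?_
    simp only [Set.mem_ofPred_eq] at hx hx₀
    have : (x - x₀) * (x - (-x₀ - s)) = 0 := by linear_combination hx - hx₀
    rcases mul_eq_zero.1 this with h | h
    · exact .inl (sub_eq_zero.1 h)
    · exact .inr (sub_eq_zero.1 h)

/-- Verschiebung, `x ↦ x + b / x`, transfers finiteness from `y² + xy = x³ + ax² + b` to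
`y² + xy = x³ + ax² + b²`. -/
theorem finite_artinSchreier_sq {F : Type*} [Field F] [CharP F 2] {a b : F}
    (h : {x : F | x ≠ 0 ∧ ∃ z, z ^ 2 + z = x + a + b / x ^ 2}.Finite) :
    {x : F | x ≠ 0 ∧ ∃ z, z ^ 2 + z = x + a + b ^ 2 / x ^ 2}.Finite := by
  refine ((h.insert 0).biUnion fun s _ => finite_setOf_quadratic s b).subset ?_
  rintro x ⟨hx, z, hz⟩
  have h2 : (2 : F) = 0 := CharTwo.two_eq_zero
  refine Set.mem_biUnion (x := x + b / x) ?_ ?_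
  · rcases eq_or_ne (x + b / x) 0 with h0 | h0
    · exact .inl h0
    · have hxb : x ^ 2 + b ≠ 0 := fun h1 => h0 (by field_simp; rw [h1, mul_zero])
      refine .inr ⟨h0, z + b / x + b / (x ^ 2 + b), ?_⟩
      have e : b / (x + b / x) ^ 2 = (b / (x ^ 2 + b)) ^ 2 + b / (x ^ 2 + b) := by
        have : x + b / x = (x ^ 2 + b) / x := by field_simp
        rw [this]
        field_simp
        linear_combination (-b ^ 2) * h2
      rw [e]
      linear_combination hz + (b ^ 2 / x ^ 2 + z * (b / x) + z * (b / (x ^ 2 + b)) +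
        b / x * (b / (x ^ 2 + b))) * h2
  · simp only [Set.mem_ofPred_eq]
    field_simp
    linear_combination (x ^ 2 + b) * h2

/-- Let `k = 𝔽₂(t)` and `E : y² + xy = x³ + t⁸x² + (t¹⁶+1)/t⁸` over `k`. Then `E(k)` is a finite
group; i.e. `E` has Mordell–Weil rank 0 over `k`. -/
theorem stmt_11 (t : RatFunc (ZMod 2)) (ht : t = RatFunc.X)
    (W : WeierstrassCurve.Affine (RatFunc (ZMod 2)))
    (hW : W = ⟨1, t ^ 8, 0, 0, (t ^ 16 + 1) / t ^ 8⟩) :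
    Finite W.Point := by
  subst ht hW
  set t : RatFunc (ZMod 2) := RatFunc.X
  have ht0 : t ≠ 0 := RatFunc.X_ne_zero
  have h2 : (2 : RatFunc (ZMod 2)) = 0 := CharTwo.two_eq_zero
  have h0 : {x : RatFunc (ZMod 2) | x ≠ 0 ∧
      ∃ z, z ^ 2 + z = x + t + ((t + 1) ^ 2 / t) / x ^ 2}.Finite := by
    convert Set.finite_empty
    ext x
    simp only [Set.mem_ofPred_eq, Set.mem_empty_iff_false, iff_false]
    rintro ⟨hx, z, hz⟩
    exact artinSchreier_ne x hx z hz
  have h3 := finite_artinSchreier_sq (finite_artinSchreier_sq (finite_artinSchreier_sq h0))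
  have hb : ((((t + 1) ^ 2 / t) ^ 2) ^ 2) ^ 2 = (t ^ 16 + 1) / t ^ 8 := by
    have : t ^ 16 + 1 = (t + 1) ^ 16 := by
      rw [show (16 : ℕ) = 2 ^ 4 by norm_num, add_pow_char_pow, one_pow]
    rw [this]
    simp only [div_pow, ← pow_mul]
  rw [hb] at h3
  set W : WeierstrassCurve.Affine (RatFunc (ZMod 2)) := ⟨1, t ^ 8, 0, 0, (t ^ 16 + 1) / t ^ 8⟩
  have hT : {P : RatFunc (ZMod 2) × RatFunc (ZMod 2) | W.Equation P.1 P.2}.Finite := by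
    refine ((h3.insert 0).biUnion fun x _ => (finite_setOf_quadratic x
      (-(x ^ 3 + t ^ 8 * x ^ 2 + (t ^ 16 + 1) / t ^ 8))).image (Prod.mk x)).subset ?_
    rintro ⟨x, y⟩ h
    simp only [Set.mem_ofPred_eq, equation_iff, W] at h
    refine Set.mem_biUnion (x := x) ?_ ⟨y, ?_, rfl⟩
    · rcases eq_or_ne x 0 with hx | hx
      · exact .inl hx
      · refine .inr ⟨hx, y / x + t ^ 4 + t ^ 2 + t, ?_⟩
        have hy : (y / x) ^ 2 + y / x = x + t ^ 8 + (t ^ 16 + 1) / t ^ 8 / x ^ 2 := by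
          generalize (t ^ 16 + 1) / t ^ 8 = b at h ⊢
          field_simp
          linear_combination h
        linear_combination hy + (t ^ 8 + t ^ 4 + t ^ 2 + y / x * (t ^ 4 + t ^ 2 + t) +
          t ^ 6 + t ^ 5 + t ^ 3) * h2
    · simp only [Set.mem_ofPred_eq]
      linear_combination h
  have := hT.to_subtype
  let f : W.Point → Option {P : RatFunc (ZMod 2) × RatFunc (ZMod 2) | W.Equation P.1 P.2}
    | .zero => none
    | .some x y h => some ⟨(x, y), h.1⟩
  refine Finite.of_injective f ?_
  rintro (_ | ⟨x, y, h⟩) (_ | ⟨x', y', h'⟩) hf <;> simp_all [f]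
end

section
/- Let 𝔽₄ be the field with 4 elements and ω ∈ 𝔽₄ an element with ω² + ω + 1 = 0. Let k₀ = 𝔽₄(t) be the rational function field over 𝔽₄, and let k = k₀[s]/(s² + ts + t³ + 1), the quadratic extension of k₀ obtained by adjoining a root s of X² + tX + (t³ + 1) (so that s² + st = t³ + 1); the polynomial X² + tX + (t³+1) is irreducible over k₀, so k is a field. Let E be the elliptic curve over k given by y² + xy = x³ + t⁸x² + ω. Then E(k) is a finite group; i.e., every k-rational point of E is torsion. -/
open Polynomial WeierstrassCurve WeierstrassCurve.Affine

/-- The polynomial `X² + tX + (t³ + 1)` over `k₀ = 𝔽₄(t)`, whose adjoined root `s` satisfies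
`s² + st = t³ + 1` (note that `-1 = 1` in characteristic 2). -/
noncomputable def qpoly : Polynomial (RatFunc (GaloisField 2 2)) :=
  X ^ 2 + C RatFunc.X * X + C (RatFunc.X ^ 3 + 1)

theorem exists_sq_eq_of_derivative_eq_zero {F : Type*} [Field F] [CharP F 2] [PerfectRing F 2]
    {f : F[X]} (hf : derivative f = 0) : ∃ g : F[X], f = g ^ 2 := by
  refine ⟨(contract 2 f).map (frobeniusEquiv F 2).symm.toRingHom, ?_⟩
  have h2 : (frobenius F 2).comp (frobeniusEquiv F 2).symm.toRingHom = RingHom.id F := by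
    ext x
    simp
  rw [← map_frobenius_expand, ← map_expand, Polynomial.map_map, h2, Polynomial.map_id,
    expand_contract 2 hf two_ne_zero]

theorem isCoprime_derivative_mul_eq_zero {F : Type*} [Field F] {f g : F[X]} (hfg : IsCoprime f g)
    (h : derivative (f * g) = 0) : derivative f = 0 := by
  rw [← dvd_derivative_iff]
  rw [derivative_mul] at h
  refine hfg.dvd_of_dvd_mul_right ⟨-derivative g, ?_⟩
  linear_combination h

theorem false_of_constant_solution {F : Type*} [Field F] {γ c : F} (hγ : γ ≠ 0) {z : F[X]}
    (h : z ^ 2 + C γ * z = C c + X * C γ ^ 2) : False := by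
  have h1 : (z * (z + C γ)).natDegree = 1 := by
    have : z * (z + C γ) = C (γ ^ 2) * X + C c := by rw [C_pow]; linear_combination h
    rw [this, natDegree_linear (pow_ne_zero 2 hγ)]
  have h0 : z * (z + C γ) ≠ 0 := fun h0 => by simp [h0] at h1
  rw [natDegree_mul (left_ne_zero_of_mul h0) (right_ne_zero_of_mul h0), natDegree_add_C] at h1
  omega

theorem eq_zero_of_integral_model {F : Type*} [Field F] [CharP F 2] [PerfectRing F 2] (N : ℕ) :
    ∀ (b : F) (n d z : F[X]), b ≠ 0 → d ≠ 0 → IsCoprime n d → n.natDegree + d.natDegree ≤ N →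
      z ^ 2 + n * d * z = n ^ 3 * d + X ^ 2 * n ^ 2 * d ^ 2 + C b * d ^ 4 → n = 0 := by
  induction N using Nat.strong_induction_on with
  | _ N ih =>
  intro b n d z hb hd hnd hN h
  by_contra hn
  have two : (2 : F[X]) = 0 := CharP.cast_eq_zero F[X] 2
  have hder := congrArg derivative h
  have hder' : derivative n * (d * (z + n ^ 2)) = n * (derivative (d * (z + n ^ 2))) := by
    simp only [derivative_add, derivative_mul, derivative_pow, derivative_X, derivative_C,
      Nat.cast_ofNat, map_ofNat] at hder ⊢
    linear_combination hder + two * (n ^ 2 * derivative n * d - z * derivative z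
      - n * derivative d * z - n * d * derivative z + X * n ^ 2 * d ^ 2
      + X ^ 2 * n * derivative n * d ^ 2 + X ^ 2 * n ^ 2 * d * derivative d
      + 2 * C b * d ^ 3 * derivative d)
  have hbu : IsUnit (C b) := isUnit_C.mpr hb.isUnit
  have hnz : IsCoprime n z := by
    have h1 : IsCoprime n (C b * d ^ 4) :=
      (isCoprime_mul_unit_left_right hbu _ _).mpr hnd.pow_right
    have h2 : z ^ 2 = C b * d ^ 4 + n * (n ^ 2 * d + X ^ 2 * n * d ^ 2 - d * z) := by
      linear_combination h
    rw [← IsCoprime.pow_right_iff two_pos, h2]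
    exact IsCoprime.add_mul_left_right_iff.mpr h1
  have hnzn : IsCoprime n (z + n ^ 2) := by
    rw [pow_two]
    exact IsCoprime.add_mul_left_right_iff.mpr hnz
  have hn' : derivative n = 0 := by
    rw [← dvd_derivative_iff]
    exact (hnd.mul_right hnzn).dvd_of_dvd_mul_right ⟨_, hder'⟩
  rw [hn', zero_mul] at hder'
  have hw : derivative (d * (z + n ^ 2)) = 0 := by simpa [hn] using hder'.symm
  have hdz : IsCoprime d (z + n ^ 2) := by
    have h1 : IsCoprime d (n ^ 4) := hnd.symm.pow_right
    have h2 : (z + n ^ 2) ^ 2 = n ^ 4 +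
        d * (n ^ 3 + X ^ 2 * n ^ 2 * d + C b * d ^ 3 - n * z) + 2 * (n ^ 2 * z) := by
      linear_combination h
    rw [← IsCoprime.pow_right_iff two_pos, h2, two, zero_mul, add_zero]
    exact IsCoprime.add_mul_left_right_iff.mpr h1
  have hd' : derivative d = 0 := isCoprime_derivative_mul_eq_zero hdz hw
  have hz' : derivative z = 0 := by
    have := isCoprime_derivative_mul_eq_zero hdz.symm (by rwa [mul_comm])
    simpa [derivative_pow, hn'] using this
  obtain ⟨n, rfl⟩ := exists_sq_eq_of_derivative_eq_zero hn'
  obtain ⟨d, rfl⟩ := exists_sq_eq_of_derivative_eq_zero hd'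
  obtain ⟨z, rfl⟩ := exists_sq_eq_of_derivative_eq_zero hz'
  obtain ⟨c, rfl⟩ : ∃ c, b = c ^ 2 :=
    ⟨(frobeniusEquiv F 2).symm b, (frobeniusEquiv_symm_pow_p F 2 b).symm⟩
  have key : z ^ 2 + n * d * z = n ^ 3 * d + X * n ^ 2 * d ^ 2 + C c * d ^ 4 := by
    apply CharTwo.sq_injective
    rw [C_pow] at h
    linear_combination h + two * (n * d * z ^ 3 - n ^ 3 * d * X * n ^ 2 * d ^ 2
      - n ^ 3 * d * C c * d ^ 4 - X * n ^ 2 * d ^ 2 * C c * d ^ 4)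
  have hn0 : n ≠ 0 := by rintro rfl; simp at hn
  have hd0 : d ≠ 0 := by rintro rfl; simp at hd
  rw [natDegree_pow, natDegree_pow] at hN
  rcases Nat.eq_zero_or_pos (n.natDegree + d.natDegree) with h0 | h0
  · obtain ⟨α, rfl⟩ := natDegree_eq_zero.mp (Nat.add_eq_zero_iff.mp h0).1
    obtain ⟨β, rfl⟩ := natDegree_eq_zero.mp (Nat.add_eq_zero_iff.mp h0).2
    refine false_of_constant_solution (γ := α * β) (c := α ^ 3 * β + c * β ^ 4) (z := z)
      (mul_ne_zero (by simpa using hn0) (by simpa using hd0)) ?_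
    simp only [C_mul, C_add, C_pow]
    linear_combination key
  · refine hn0 (ih (n.natDegree + d.natDegree) (by omega) c n d (z + X * n * d)
      (by rintro rfl; simp at hb) hd0 ?_ le_rfl ?_)
    · exact (IsCoprime.pow_iff two_pos two_pos).mp hnd
    · linear_combination key + two * (X * n * d * z + X * n ^ 2 * d ^ 2)

theorem ratFunc_two_eq_zero {F : Type*} [Field F] [CharP F 2] : (2 : RatFunc F) = 0 := by
  simpa only [map_ofNat, map_zero] using congrArg (RatFunc.C (K := F)) CharTwo.two_eq_zero

theorem ratFunc_x_eq_zero {F : Type*} [Field F] [CharP F 2] [PerfectRing F 2] {b : F} (hb : b ≠ 0)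
    {x y : RatFunc F} (h : y ^ 2 + x * y = x ^ 3 + RatFunc.X ^ 2 * x ^ 2 + RatFunc.C b) :
    x = 0 := by
  set n := algebraMap F[X] (RatFunc F) x.num with hn
  set d := algebraMap F[X] (RatFunc F) x.denom with hd
  have hd0 : d ≠ 0 := RatFunc.algebraMap_ne_zero x.denom_ne_zero
  have hx : x * d = n :=
    ((eq_div_iff hd0).mp (RatFunc.num_div_denom x).symm)
  have hz : (d ^ 2 * y) ^ 2 + n * d * (d ^ 2 * y) =
      n ^ 3 * d + RatFunc.X ^ 2 * n ^ 2 * d ^ 2 + RatFunc.C b * d ^ 4 := by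
    rw [← hx]
    linear_combination d ^ 4 * h
  have hint : _root_.IsIntegral F[X] (d ^ 2 * y) := by
    refine ⟨X ^ 2 + (C (x.num * x.denom) * X + C (-(x.num ^ 3 * x.denom + X ^ 2 * x.num ^ 2 *
      x.denom ^ 2 + C b * x.denom ^ 4))), ?_, ?_⟩
    · exact monic_X_pow_add (degree_linear_lt)
    · rw [eval₂_add, eval₂_add, eval₂_mul, eval₂_pow, eval₂_X, eval₂_C, eval₂_C]
      simp only [map_neg, map_add, map_mul,
        map_pow, RatFunc.algebraMap_X, RatFunc.algebraMap_C, ← hn, ← hd]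
      linear_combination hz
  obtain ⟨z, hz'⟩ := IsIntegrallyClosed.isIntegral_iff.mp hint
  rw [← hz'] at hz
  rw [← RatFunc.num_eq_zero_iff]
  refine eq_zero_of_integral_model _ b x.num x.denom z hb x.denom_ne_zero
    (RatFunc.isCoprime_num_denom x) le_rfl (RatFunc.algebraMap_injective F ?_)
  simpa only [map_add, map_mul, map_pow, RatFunc.algebraMap_X, RatFunc.algebraMap_C] using hz

theorem ratFunc_x_eq_zero_of_twist {F : Type*} [Field F] [CharP F 2] [PerfectRing F 2] {b : F}
    (hb : b ≠ 0) {x y a : RatFunc F} (g : RatFunc F) (ha : a = RatFunc.X ^ 2 + (g ^ 2 + g))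
    (h : y ^ 2 + x * y = x ^ 3 + a * x ^ 2 + RatFunc.C b) : x = 0 := by
  refine ratFunc_x_eq_zero hb (x := x) (y := y + g * x) ?_
  subst ha
  linear_combination h + ratFunc_two_eq_zero (F := F) * (g * x * y + (g ^ 2 + g) * x ^ 2)

theorem ratFunc_x_eq_zero_of_inv_twist {F : Type*} [Field F] [CharP F 2] [PerfectRing F 2] {b : F}
    (hb : b ≠ 0) {x y a : RatFunc F} (g : RatFunc F) (ha : a = RatFunc.X⁻¹ ^ 2 + (g ^ 2 + g))
    (h : y ^ 2 + x * y = x ^ 3 + a * x ^ 2 + RatFunc.C b) : x = 0 := by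
  have htr : Transcendental F (RatFunc.X⁻¹ : RatFunc F) := fun hX =>
    RatFunc.transcendental_X (IsAlgebraic.inv_iff.mp hX)
  let φ : RatFunc F →ₐ[F] RatFunc F := (IntermediateField.val _).comp
    (RatFunc.algEquivOfTranscendental _ htr).toAlgHom
  have hφX : φ RatFunc.X = RatFunc.X⁻¹ := RatFunc.algEquivOfTranscendental_X _ htr
  have hφC : φ (RatFunc.C b) = RatFunc.C b := φ.commutes b
  refine (map_eq_zero φ).mp (ratFunc_x_eq_zero_of_twist hb (y := φ y) (a := φ a) (φ g) ?_ ?_)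
  · simp [ha, hφX]
  · simpa [hφC] using congrArg φ h

theorem monic_qpoly : qpoly.Monic := by
  unfold qpoly
  rw [add_assoc]
  exact monic_X_pow_add degree_linear_lt

theorem natDegree_qpoly : qpoly.natDegree = 2 := by
  unfold qpoly
  compute_degree!

theorem two_eq_zero_adjoinRoot_qpoly : (2 : AdjoinRoot qpoly) = 0 := by
  simpa only [map_ofNat, map_zero] using
    congrArg (AdjoinRoot.of qpoly) (ratFunc_two_eq_zero (F := GaloisField 2 2))

theorem root_qpoly_sq : AdjoinRoot.root qpoly ^ 2 +
    AdjoinRoot.of qpoly RatFunc.X * AdjoinRoot.root qpoly +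
      (AdjoinRoot.of qpoly RatFunc.X ^ 3 + 1) = 0 := by
  have h := AdjoinRoot.eval₂_root qpoly
  conv at h => enter [1, 3]; unfold qpoly
  simpa only [eval₂_add, eval₂_mul, eval₂_pow, eval₂_X, eval₂_C, eval₂_one, map_add, map_pow,
    map_one] using h

theorem exists_eq_add_mul_root (x : AdjoinRoot qpoly) : ∃ a b : RatFunc (GaloisField 2 2),
    x = AdjoinRoot.of qpoly a + AdjoinRoot.of qpoly b * AdjoinRoot.root qpoly := by
  obtain ⟨f, rfl⟩ := AdjoinRoot.mk_surjective x
  have hdeg : (f %ₘ qpoly).natDegree ≤ 1 := by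
    have := natDegree_modByMonic_lt f monic_qpoly (fun h => by
      simpa [h] using natDegree_qpoly)
    rw [natDegree_qpoly] at this
    omega
  obtain ⟨b, a, hab⟩ := exists_eq_X_add_C_of_natDegree_le_one hdeg
  refine ⟨a, b, ?_⟩
  have h : AdjoinRoot.mk qpoly f = AdjoinRoot.mk qpoly (f %ₘ qpoly) := by
    conv_lhs => rw [← modByMonic_add_div f qpoly]
    simp
  rw [h, hab]
  simp [add_comm]

/-- The conjugation `s ↦ s + t` of `k` over `k₀`. -/
noncomputable def conj : AdjoinRoot qpoly →ₐ[RatFunc (GaloisField 2 2)] AdjoinRoot qpoly :=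
  AdjoinRoot.liftAlgHom qpoly (Algebra.ofId _ _)
    (AdjoinRoot.root qpoly + AdjoinRoot.of qpoly RatFunc.X) (by
      conv => enter [1, 3]; unfold qpoly
      simp only [eval₂_add, eval₂_mul, eval₂_pow, eval₂_X, eval₂_C, eval₂_one, map_add, map_pow,
        map_one]
      change _ + AdjoinRoot.of qpoly RatFunc.X * _ + (AdjoinRoot.of qpoly RatFunc.X ^ 3 + 1) = 0
      linear_combination root_qpoly_sq + two_eq_zero_adjoinRoot_qpoly *
        (AdjoinRoot.of qpoly RatFunc.X * AdjoinRoot.root qpoly + AdjoinRoot.of qpoly RatFunc.X ^ 2))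

theorem conj_of (a : RatFunc (GaloisField 2 2)) :
    conj (AdjoinRoot.of qpoly a) = AdjoinRoot.of qpoly a :=
  conj.commutes a

theorem conj_root : conj (AdjoinRoot.root qpoly) =
    AdjoinRoot.root qpoly + AdjoinRoot.of qpoly RatFunc.X :=
  AdjoinRoot.liftAlgHom_root ..

theorem conj_conj (x : AdjoinRoot qpoly) : conj (conj x) = x := by
  obtain ⟨a, b, rfl⟩ := exists_eq_add_mul_root x
  simp only [map_add, map_mul, conj_of, conj_root]
  linear_combination two_eq_zero_adjoinRoot_qpoly *
    (AdjoinRoot.of qpoly b * AdjoinRoot.of qpoly RatFunc.X)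

section

variable [Fact (Irreducible qpoly)]

theorem exists_of_eq_of_conj_eq_add {x : RatFunc (GaloisField 2 2)} {y : AdjoinRoot qpoly}
    (hy : conj y = y + AdjoinRoot.of qpoly x) : ∃ a : RatFunc (GaloisField 2 2),
      y = AdjoinRoot.of qpoly a + AdjoinRoot.of qpoly (x / RatFunc.X) * AdjoinRoot.root qpoly := by
  obtain ⟨a, b, rfl⟩ := exists_eq_add_mul_root y
  simp only [map_add, map_mul, conj_of, conj_root] at hy
  have hb : b * RatFunc.X = x := by
    apply (AdjoinRoot.of qpoly).injective
    rw [map_mul]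
    linear_combination hy
  exact ⟨a, by rw [← hb, mul_div_cancel_right₀ _ RatFunc.X_ne_zero]⟩

theorem exists_of_eq_of_conj_eq {y : AdjoinRoot qpoly} (hy : conj y = y) :
    ∃ a : RatFunc (GaloisField 2 2), y = AdjoinRoot.of qpoly a := by
  obtain ⟨a, ha⟩ := exists_of_eq_of_conj_eq_add (x := 0) (y := y) (by simpa using hy)
  exact ⟨a, by simpa using ha⟩

theorem x_eq_zero_of_conj_eq {ω : GaloisField 2 2} (hω : ω ≠ 0) {x y : AdjoinRoot qpoly}
    (h : y ^ 2 + x * y = x ^ 3 + AdjoinRoot.of qpoly RatFunc.X ^ 8 * x ^ 2 +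
      AdjoinRoot.of qpoly (RatFunc.C ω)) (hx : conj x = x) (hy : conj y = y) : x = 0 := by
  obtain ⟨x, rfl⟩ := exists_of_eq_of_conj_eq hx
  obtain ⟨y, rfl⟩ := exists_of_eq_of_conj_eq hy
  simp only [← map_pow, ← map_mul, ← map_add] at h
  rw [ratFunc_x_eq_zero_of_twist hω (RatFunc.X ^ 4 + RatFunc.X ^ 2) ?_
    ((AdjoinRoot.of qpoly).injective h), map_zero]
  linear_combination -(ratFunc_two_eq_zero (F := GaloisField 2 2)) *
    (RatFunc.X ^ 6 + RatFunc.X ^ 4 + RatFunc.X ^ 2)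

theorem x_eq_zero_of_conj_eq_add {ω : GaloisField 2 2} (hω : ω ≠ 0) {x y : AdjoinRoot qpoly}
    (h : y ^ 2 + x * y = x ^ 3 + AdjoinRoot.of qpoly RatFunc.X ^ 8 * x ^ 2 +
      AdjoinRoot.of qpoly (RatFunc.C ω)) (hx : conj x = x) (hy : conj y = y + x) : x = 0 := by
  obtain ⟨x, rfl⟩ := exists_of_eq_of_conj_eq hx
  obtain ⟨a, rfl⟩ := exists_of_eq_of_conj_eq_add hy
  have hX : (RatFunc.X : RatFunc (GaloisField 2 2)) ≠ 0 := RatFunc.X_ne_zero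
  obtain ⟨c, rfl⟩ : ∃ c, x = c * RatFunc.X := ⟨x / RatFunc.X, by field_simp⟩
  rw [mul_div_cancel_right₀ _ hX] at h
  have h' : a ^ 2 + (c * RatFunc.X) * a = (c * RatFunc.X) ^ 3 +
      (RatFunc.X ^ 8 + RatFunc.X + RatFunc.X⁻¹ ^ 2) * (c * RatFunc.X) ^ 2 + RatFunc.C ω := by
    have e : (RatFunc.X ^ 8 + RatFunc.X + RatFunc.X⁻¹ ^ 2) * (c * RatFunc.X) ^ 2 =
      RatFunc.X ^ 8 * (c * RatFunc.X) ^ 2 + c ^ 2 * (RatFunc.X ^ 3 + 1) := by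
      field_simp
      ring
    rw [e]
    apply (AdjoinRoot.of qpoly).injective
    simp only [map_add, map_mul, map_pow, map_one] at h ⊢
    linear_combination h - AdjoinRoot.of qpoly c ^ 2 * root_qpoly_sq -
      two_eq_zero_adjoinRoot_qpoly * (AdjoinRoot.of qpoly a * AdjoinRoot.of qpoly c *
        AdjoinRoot.root qpoly)
  rw [ratFunc_x_eq_zero_of_inv_twist hω (RatFunc.X ^ 4 + RatFunc.X ^ 2 + RatFunc.X) ?_ h',
    map_zero]
  linear_combination -(ratFunc_two_eq_zero (F := GaloisField 2 2)) *
    (RatFunc.X ^ 6 + RatFunc.X ^ 5 + RatFunc.X ^ 4 + RatFunc.X ^ 3 + RatFunc.X ^ 2)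

/-- The curve `y² + xy = x³ + t⁸x² + ω` over `k₀`. -/
noncomputable def baseCurve (ω : GaloisField 2 2) :
    WeierstrassCurve.Affine (RatFunc (GaloisField 2 2)) :=
  ⟨1, RatFunc.X ^ 8, 0, 0, RatFunc.C ω⟩

theorem equation_of_nonsingular {ω : GaloisField 2 2} {x y : AdjoinRoot qpoly}
    (h : ((baseCurve ω)⁄(AdjoinRoot qpoly)).Nonsingular x y) :
    y ^ 2 + x * y = x ^ 3 + AdjoinRoot.of qpoly RatFunc.X ^ 8 * x ^ 2 +
      AdjoinRoot.of qpoly (RatFunc.C ω) := by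
  have := (equation_iff _ _).mp h.1
  simpa [baseCurve, WeierstrassCurve.map, AdjoinRoot.algebraMap_eq] using this

theorem two_nsmul_eq_zero_iff [DecidableEq (AdjoinRoot qpoly)] {ω : GaloisField 2 2}
    {x y : AdjoinRoot qpoly} (h : ((baseCurve ω)⁄(AdjoinRoot qpoly)).Nonsingular x y) :
    2 • (Point.some x y h) = 0 ↔ x = 0 := by
  rw [two_nsmul, add_eq_zero_iff_eq_neg, Point.neg_some]
  simp only [Point.some.injEq, negY, true_and]
  have h1 : ((baseCurve ω)⁄(AdjoinRoot qpoly)).a₁ = 1 := by simp [baseCurve]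
  have h3 : ((baseCurve ω)⁄(AdjoinRoot qpoly)).a₃ = 0 := by simp [baseCurve]
  rw [h1, h3]
  constructor <;> intro hh
  · linear_combination hh - two_eq_zero_adjoinRoot_qpoly * y
  · linear_combination two_eq_zero_adjoinRoot_qpoly * y + hh

theorem four_nsmul_eq_zero [DecidableEq (AdjoinRoot qpoly)] {ω : GaloisField 2 2} (hω : ω ≠ 0)
    (P : ((baseCurve ω)⁄(AdjoinRoot qpoly)).Point) : 2 • (2 • P) = 0 := by
  let σ := Point.map (W' := baseCurve ω) conj
  have hσσ : σ (σ P) = P := by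
    rcases P with _ | ⟨x, y, h⟩
    · rfl
    · simp only [σ, Point.map_some, conj_conj]
  have key1 : ∀ Q, σ Q = Q → 2 • Q = 0 := by
    rintro (_ | ⟨x, y, h⟩) hQ
    · rfl
    · simp only [σ, Point.map_some, Point.some.injEq] at hQ
      exact (two_nsmul_eq_zero_iff h).mpr
        (x_eq_zero_of_conj_eq hω (equation_of_nonsingular h) hQ.1 hQ.2)
  have key2 : ∀ Q, σ Q = -Q → 2 • Q = 0 := by
    rintro (_ | ⟨x, y, h⟩) hQ
    · rfl
    · have h1 : ((baseCurve ω)⁄(AdjoinRoot qpoly)).a₁ = 1 := by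
        simp [baseCurve]
      have h3 : ((baseCurve ω)⁄(AdjoinRoot qpoly)).a₃ = 0 := by
        simp [baseCurve]
      simp only [σ, Point.neg_some, Point.map_some, Point.some.injEq, negY, h1, h3] at hQ
      refine (two_nsmul_eq_zero_iff h).mpr
        (x_eq_zero_of_conj_eq_add hω (equation_of_nonsingular h) hQ.1 ?_)
      linear_combination hQ.2 - two_eq_zero_adjoinRoot_qpoly * (y + x)
  have e1 := key1 (P + σ P) (by rw [map_add, hσσ, add_comm])
  have e2 := key2 (P - σ P) (by rw [map_sub, hσσ, neg_sub])
  have e : 2 • (2 • P) = 2 • (P + σ P) + 2 • (P - σ P) := by abel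
  rw [e, e1, e2, add_zero]

theorem finite_two_torsion [DecidableEq (AdjoinRoot qpoly)] (ω : GaloisField 2 2) :
    {P : ((baseCurve ω)⁄(AdjoinRoot qpoly)).Point | 2 • P = 0}.Finite := by
  refine Set.Subsingleton.finite ?_ |>.insert 0 |>.subset
    (s := insert 0 {P | 2 • P = 0 ∧ P ≠ 0}) fun P hP => ?_
  · rintro (_ | ⟨x, y, h⟩) ⟨hP, hP0⟩ (_ | ⟨x', y', h'⟩) ⟨hQ, hQ0⟩
    · rfl
    · exact absurd rfl hP0
    · exact absurd rfl hQ0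
    · have hx := (two_nsmul_eq_zero_iff h).mp hP
      have hx' := (two_nsmul_eq_zero_iff h').mp hQ
      subst hx hx'
      have e := equation_of_nonsingular h
      have e' := equation_of_nonsingular h'
      have : (y - y') ^ 2 = 0 := by
        linear_combination e - e' + two_eq_zero_adjoinRoot_qpoly * (y' ^ 2 - y * y')
      obtain rfl : y = y' := sub_eq_zero.mp (pow_eq_zero_iff two_ne_zero |>.mp this)
      rfl
  · by_cases h : P = 0
    · exact Or.inl h
    · exact Or.inr ⟨hP, h⟩

theorem finite_point_baseCurve {ω : GaloisField 2 2} (hω : ω ≠ 0) :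
    Finite ((baseCurve ω)⁄(AdjoinRoot qpoly)).Point := by
  classical
  have hfin := finite_two_torsion ω
  rw [← Set.finite_univ_iff]
  refine Set.Finite.of_finite_fibers (fun P => 2 • P) (hfin.subset ?_) fun Q _ => ?_
  · rintro _ ⟨P, -, rfl⟩
    exact four_nsmul_eq_zero hω P
  · rw [Set.univ_inter]
    rcases Set.eq_empty_or_nonempty ((fun P => 2 • P) ⁻¹' {Q}) with h | ⟨P, hP⟩
    · exact h ▸ Set.finite_empty
    · refine (hfin.image (P + ·)).subset fun P' hP' => ⟨P' - P, ?_, by simp⟩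
      simp only [Set.mem_preimage, Set.mem_singleton_iff, Set.mem_ofPred_eq] at hP hP' ⊢
      rw [nsmul_sub, hP, hP', sub_self]

end

/-- Let `𝔽₄` be the field with 4 elements, `ω ∈ 𝔽₄` with `ω² + ω + 1 = 0`, `k₀ = 𝔽₄(t)`, and
`k = k₀[s]/(s² + ts + t³ + 1)` the quadratic extension obtained by adjoining a root `s` of the
irreducible polynomial `X² + tX + (t³ + 1)` (so `s² + st = t³ + 1`). Let `E` be the elliptic curve
`y² + xy = x³ + t⁸x² + ω` over `k`. Then `E(k)` is a finite group, i.e. every `k`-rational point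
of `E` is torsion. -/
theorem stmt_14 [Fact (Irreducible qpoly)] (ω : GaloisField 2 2) (hω : ω ^ 2 + ω + 1 = 0)
    (W : WeierstrassCurve.Affine (AdjoinRoot qpoly))
    (hW : W = ⟨1, (AdjoinRoot.of qpoly RatFunc.X) ^ 8, 0, 0,
      AdjoinRoot.of qpoly (RatFunc.C ω)⟩) :
    Finite W.Point := by
  have hω0 : ω ≠ 0 := by rintro rfl; simp at hω
  have hW' : W = (baseCurve ω)⁄(AdjoinRoot qpoly) := by
    rw [hW]
    ext <;> simp [baseCurve, AdjoinRoot.algebraMap_eq]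
  rw [hW']
  exact finite_point_baseCurve hω0
end
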